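/- With the notation of the encoding/measurement setup, the identity χ{p_f, ρ_f} + Σ_{ω: p_f(ω)>0} p_f(ω) χ{p_{i|f}(·|ω), ρ_f^•(ω)} = χ{p_i, η_f^•} + Σ_{α: p_i(α)>0} p_i(α) χ{p_{f|i}(·|α), ρ_f^α} holds, where for each α the ensemble {p_{f|i}(·|α), ρ_f^α} has average state η_f^α and both {p_f, ρ_f} and {p_i, η_f^•} have average state η_f. -/

import Mathlib

open Matrix Finset
open scoped BigOperators ComplexOrder

noncomputable section

/-- Matrix logarithm of a Hermitian matrix via the spectral decomposition
(with the convention `Real.log 0 = 0` on the kernel); `0` for non-Hermitian matrices. -/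
def matLog {d : ℕ} (A : Matrix (Fin d) (Fin d) ℂ) : Matrix (Fin d) (Fin d) ℂ :=
  if hA : A.IsHermitian then
    (hA.eigenvectorUnitary : Matrix (Fin d) (Fin d) ℂ) *
      Matrix.diagonal (fun i => (Real.log (hA.eigenvalues i) : ℂ)) *
      star (hA.eigenvectorUnitary : Matrix (Fin d) (Fin d) ℂ)
  else 0

/-- The von Neumann entropy `S_q(ρ) = −Tr(ρ log ρ)`. -/
def vnEntropy {d : ℕ} (ρ : Matrix (Fin d) (Fin d) ℂ) : ℝ :=
  -(Matrix.trace (ρ * matLog ρ)).re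

/-- The quantum relative entropy `S_q(ρ‖φ) = Tr(ρ (log ρ − log φ))`. -/
def qRelEntropy {d : ℕ} (ρ φ : Matrix (Fin d) (Fin d) ℂ) : ℝ :=
  (Matrix.trace (ρ * (matLog ρ - matLog φ))).re

/-- The classical relative entropy `S_c(p‖q) = Σ_{ω : p ω > 0} p ω log (p ω / q ω)`. -/
def cRelEntropy {Ω : Type*} [Fintype Ω] (p q : Ω → ℝ) : ℝ :=
  ∑ ω ∈ Finset.univ.filter (fun ω => 0 < p ω), p ω * Real.log (p ω / q ω)

/-- The probability of outcome `ω` for POV measure `E` in the state `ρ`. -/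
def povProb {d : ℕ} {Ω : Type*} (E : Ω → Matrix (Fin d) (Fin d) ℂ)
    (ρ : Matrix (Fin d) (Fin d) ℂ) (ω : Ω) : ℝ :=
  (Matrix.trace (E ω * ρ)).re

/-- The χ-quantity of the ensemble `{p, σ}` (relative entropies w.r.t. the average state). -/
def chiQuantity {d : ℕ} {X : Type*} [Fintype X] (p : X → ℝ)
    (σ : X → Matrix (Fin d) (Fin d) ℂ) : ℝ :=
  ∑ x ∈ Finset.univ.filter (fun x => 0 < p x),
    p x * qRelEntropy (σ x) (∑ y, p y • σ y)

/-- The operation `O(ω)[ρ] = Σ_k V_k^ω ρ (V_k^ω)†` of the instrument with Kraus family `V`. -/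
def instrOp {d : ℕ} {Ω K : Type*} [Fintype K] (V : Ω → K → Matrix (Fin d) (Fin d) ℂ)
    (ω : Ω) (ρ : Matrix (Fin d) (Fin d) ℂ) : Matrix (Fin d) (Fin d) ℂ :=
  ∑ k, V ω k * ρ * (V ω k)ᴴ

/-- The POV measure `E(ω) = Σ_k (V_k^ω)† V_k^ω` associated with the instrument `V`. -/
def instrPOV {d : ℕ} {Ω K : Type*} [Fintype K] (V : Ω → K → Matrix (Fin d) (Fin d) ℂ)
    (ω : Ω) : Matrix (Fin d) (Fin d) ℂ :=
  ∑ k, (V ω k)ᴴ * V ω k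

/-- The outcome probability `p_ρ(ω) = Tr(E(ω) ρ)` of the instrument `V`. -/
def outcomeProb {d : ℕ} {Ω K : Type*} [Fintype K] (V : Ω → K → Matrix (Fin d) (Fin d) ℂ)
    (ρ : Matrix (Fin d) (Fin d) ℂ) (ω : Ω) : ℝ :=
  (Matrix.trace (instrPOV V ω * ρ)).re

/-- The a posteriori state `π_ρ(ω) = O(ω)[ρ] / p_ρ(ω)` of the instrument `V`. -/
def postState {d : ℕ} {Ω K : Type*} [Fintype K] (V : Ω → K → Matrix (Fin d) (Fin d) ℂ)
    (ρ : Matrix (Fin d) (Fin d) ℂ) (ω : Ω) : Matrix (Fin d) (Fin d) ℂ :=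
  (outcomeProb V ρ ω)⁻¹ • instrOp V ω ρ

/-- The classical input/output mutual information `I_c{p, ρ; E}` for the ensemble `{p, ρ}`
measured with the POV measure `E`. -/
def mutualInfo {d : ℕ} {A Ω : Type*} [Fintype A] [Fintype Ω]
    (p : A → ℝ) (ρ : A → Matrix (Fin d) (Fin d) ℂ)
    (E : Ω → Matrix (Fin d) (Fin d) ℂ) : ℝ :=
  ∑ x ∈ Finset.univ.filter (fun x : A × Ω => 0 < p x.1 * povProb E (ρ x.1) x.2),
    (p x.1 * povProb E (ρ x.1) x.2) *
      Real.log ((p x.1 * povProb E (ρ x.1) x.2) /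
        (p x.1 * povProb E (∑ α, p α • ρ α) x.2))

/-- The quantum information gain `I_q(ρ; I)` of the instrument `V` on the state `ρ`. -/
def infoGain {d : ℕ} {Ω K : Type*} [Fintype Ω] [Fintype K]
    (V : Ω → K → Matrix (Fin d) (Fin d) ℂ) (ρ : Matrix (Fin d) (Fin d) ℂ) : ℝ :=
  vnEntropy ρ - ∑ ω ∈ Finset.univ.filter (fun ω => 0 < outcomeProb V ρ ω),
    outcomeProb V ρ ω * vnEntropy (postState V ρ ω)

/-- A pure state: a rank-one orthogonal projection. -/
def IsPureState {d : ℕ} (ρ : Matrix (Fin d) (Fin d) ℂ) : Prop :=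
  ρ.IsHermitian ∧ ρ * ρ = ρ ∧ ρ.rank = 1

end
/-- The functional `Tr(σ log σ)`. -/
noncomputable def trMulLog {d : ℕ} (σ : Matrix (Fin d) (Fin d) ℂ) : ℝ :=
  (Matrix.trace (σ * matLog σ)).re

theorem chiQuantity_eq {d : ℕ} {X : Type*} [Fintype X] (p : X → ℝ) (hp : ∀ x, 0 ≤ p x)
    (σ : X → Matrix (Fin d) (Fin d) ℂ) (σbar : Matrix (Fin d) (Fin d) ℂ)
    (hbar : ∑ x, p x • σ x = σbar) :
    chiQuantity p σ = ∑ x, p x * trMulLog (σ x) - trMulLog σbar := by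
  have hlin : trMulLog σbar = ∑ x, p x * (Matrix.trace (σ x * matLog σbar)).re := by
    unfold trMulLog
    generalize matLog σbar = L
    rw [← hbar, Finset.sum_mul, Matrix.trace_sum, Complex.re_sum]
    refine Finset.sum_congr rfl fun x _ => ?_
    rw [Matrix.smul_mul, Matrix.trace_smul, Complex.smul_re, smul_eq_mul]
  rw [chiQuantity, hbar, hlin, ← Finset.sum_sub_distrib, Finset.sum_filter]
  refine Finset.sum_congr rfl fun x _ => ?_
  split_ifs with h
  · rw [qRelEntropy, trMulLog, Matrix.mul_sub, Matrix.trace_sub, Complex.sub_re, mul_sub]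
  · rw [le_antisymm (not_lt.mp h) (hp x)]
    simp

section Instrument

variable {d : ℕ} {Ω K : Type*} [Fintype K] (V : Ω → K → Matrix (Fin d) (Fin d) ℂ) (ω : Ω)

theorem instrOp_posSemidef {ρ : Matrix (Fin d) (Fin d) ℂ} (hρ : ρ.PosSemidef) :
    (instrOp V ω ρ).PosSemidef :=
  Matrix.posSemidef_sum _ fun k _ => hρ.mul_mul_conjTranspose_same (V ω k)

theorem outcomeProb_eq_trace_instrOp (ρ : Matrix (Fin d) (Fin d) ℂ) :
    outcomeProb V ρ ω = (instrOp V ω ρ).trace.re := by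
  rw [outcomeProb, instrPOV, instrOp, Finset.sum_mul, Matrix.trace_sum, Matrix.trace_sum]
  congr 1
  refine Finset.sum_congr rfl fun k _ => ?_
  rw [Matrix.mul_assoc, Matrix.trace_mul_comm]

theorem outcomeProb_nonneg {ρ : Matrix (Fin d) (Fin d) ℂ} (hρ : ρ.PosSemidef) :
    0 ≤ outcomeProb V ρ ω := by
  rw [outcomeProb_eq_trace_instrOp]
  exact (Complex.le_def.mp (instrOp_posSemidef V ω hρ).trace_nonneg).1

theorem instrOp_eq_zero_of_outcomeProb_eq_zero {ρ : Matrix (Fin d) (Fin d) ℂ}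
    (hρ : ρ.PosSemidef) (h : outcomeProb V ρ ω = 0) : instrOp V ω ρ = 0 := by
  have hO := instrOp_posSemidef V ω hρ
  rw [outcomeProb_eq_trace_instrOp] at h
  exact hO.trace_eq_zero_iff.mp
    (Complex.ext h (Complex.le_def.mp hO.trace_nonneg).2.symm)

/-- Holds even if the probability is zero. -/
theorem outcomeProb_smul_inv_smul_instrOp {ρ : Matrix (Fin d) (Fin d) ℂ} (hρ : ρ.PosSemidef) :
    outcomeProb V ρ ω • (outcomeProb V ρ ω)⁻¹ • instrOp V ω ρ = instrOp V ω ρ := by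
  by_cases h : outcomeProb V ρ ω = 0
  · simp [instrOp_eq_zero_of_outcomeProb_eq_zero V ω hρ h]
  · exact smul_inv_smul₀ h _

theorem instrOp_sum_smul {A : Type*} [Fintype A] (p : A → ℝ)
    (ρ : A → Matrix (Fin d) (Fin d) ℂ) :
    instrOp V ω (∑ α, p α • ρ α) = ∑ α, p α • instrOp V ω (ρ α) := by
  simp only [instrOp, Finset.mul_sum, Finset.sum_mul, Finset.smul_sum, Matrix.mul_smul,
    Matrix.smul_mul]
  exact Finset.sum_comm

theorem outcomeProb_sum_smul {A : Type*} [Fintype A] (p : A → ℝ)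
    (ρ : A → Matrix (Fin d) (Fin d) ℂ) :
    outcomeProb V (∑ α, p α • ρ α) ω = ∑ α, p α * outcomeProb V (ρ α) ω := by
  simp only [outcomeProb_eq_trace_instrOp, instrOp_sum_smul, Matrix.trace_sum,
    Matrix.trace_smul, Complex.re_sum, Complex.smul_re, smul_eq_mul]

end Instrument

/-- second decomposition identity for the post-measurement χ-quantities. -/
theorem chi_second_decomposition {d : ℕ} (hd : 1 ≤ d)
    {A Ω K : Type*} [Fintype A] [Fintype Ω] [Fintype K]
    (p : A → ℝ) (hp : ∀ α, 0 ≤ p α) (hp1 : ∑ α, p α = 1)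
    (ρ : A → Matrix (Fin d) (Fin d) ℂ)
    (hρ : ∀ α, (ρ α).PosSemidef) (hρtr : ∀ α, (ρ α).trace = 1)
    (V : Ω → K → Matrix (Fin d) (Fin d) ℂ)
    (hV : ∑ ω, instrPOV V ω = 1) :
    let η := ∑ α, p α • ρ α
    let pf := fun ω => outcomeProb V η ω
    let pfi := fun ω α => outcomeProb V (ρ α) ω
    let ρf := fun α ω => (pfi ω α)⁻¹ • instrOp V ω (ρ α)
    let ρfbar := fun ω => (pf ω)⁻¹ • instrOp V ω η
    let ηf := fun α => ∑ ω, instrOp V ω (ρ α)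
    chiQuantity pf ρfbar +
        ∑ ω ∈ Finset.univ.filter (fun ω => 0 < pf ω),
          pf ω * chiQuantity (fun α => p α * pfi ω α / pf ω) (fun α => ρf α ω) =
      chiQuantity p ηf +
        ∑ α ∈ Finset.univ.filter (fun α => 0 < p α),
          p α * chiQuantity (fun ω => pfi ω α) (fun ω => ρf α ω) := by
  intro η pf pfi ρf ρfbar ηf
  have hη : η.PosSemidef := Matrix.posSemidef_sum _ fun α _ => (hρ α).smul (hp α)
  have hpf : ∀ ω, 0 ≤ pf ω := fun ω => outcomeProb_nonneg V ω hη
  have hpfi : ∀ ω α, 0 ≤ pfi ω α := fun ω α => outcomeProb_nonneg V ω (hρ α)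
  have hpf_sum : ∀ ω, pf ω = ∑ α, p α * pfi ω α := fun ω => outcomeProb_sum_smul V ω p ρ
  have hρf : ∀ ω α, pfi ω α • ρf α ω = instrOp V ω (ρ α) :=
    fun ω α => outcomeProb_smul_inv_smul_instrOp V ω (hρ α)
  have hchi_f := chiQuantity_eq pf hpf ρfbar (∑ ω, instrOp V ω η)
    (Finset.sum_congr rfl fun ω _ => outcomeProb_smul_inv_smul_instrOp V ω hη)
  have hchi_i := chiQuantity_eq p hp ηf (∑ ω, instrOp V ω η) (by
    simp only [ηf, η, instrOp_sum_smul, Finset.smul_sum]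
    exact Finset.sum_comm)
  have hchi_α : ∀ α, chiQuantity (fun ω => pfi ω α) (fun ω => ρf α ω) =
      ∑ ω, pfi ω α * trMulLog (ρf α ω) - trMulLog (ηf α) := fun α =>
    chiQuantity_eq _ (fun ω => hpfi ω α) _ _ (Finset.sum_congr rfl fun ω _ => hρf ω α)
  have hchi_ω : ∀ ω, chiQuantity (fun α => p α * pfi ω α / pf ω) (fun α => ρf α ω) =
      ∑ α, p α * pfi ω α / pf ω * trMulLog (ρf α ω) - trMulLog (ρfbar ω) := fun ω =>
    chiQuantity_eq _ (fun α => div_nonneg (mul_nonneg (hp α) (hpfi ω α)) (hpf ω)) _ _ (by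
      simp only [ρfbar, η, instrOp_sum_smul, Finset.smul_sum]
      refine Finset.sum_congr rfl fun α _ => ?_
      rw [mul_div_right_comm, mul_smul, hρf, smul_smul, div_eq_inv_mul])
  have hsum_ω : ∑ ω ∈ Finset.univ.filter (fun ω => 0 < pf ω),
      pf ω * chiQuantity (fun α => p α * pfi ω α / pf ω) (fun α => ρf α ω) =
      ∑ ω, ∑ α, p α * pfi ω α * trMulLog (ρf α ω) - ∑ ω, pf ω * trMulLog (ρfbar ω) := by
    rw [← Finset.sum_sub_distrib, Finset.sum_filter]
    refine Finset.sum_congr rfl fun ω _ => ?_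
    split_ifs with h
    · rw [hchi_ω, mul_sub, Finset.mul_sum]
      congr 1
      refine Finset.sum_congr rfl fun α _ => ?_
      field_simp
    · have h0 : pf ω = 0 := le_antisymm (not_lt.mp h) (hpf ω)
      have hterm : ∀ α ∈ Finset.univ, p α * pfi ω α = 0 :=
        (Finset.sum_eq_zero_iff_of_nonneg fun α _ => mul_nonneg (hp α) (hpfi ω α)).mp
          ((hpf_sum ω).symm.trans h0)
      rw [h0, zero_mul, sub_zero]
      exact (Finset.sum_eq_zero fun α hα => by rw [hterm α hα, zero_mul]).symm
  have hsum_α : ∑ α ∈ Finset.univ.filter (fun α => 0 < p α),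
      p α * chiQuantity (fun ω => pfi ω α) (fun ω => ρf α ω) =
      ∑ α, ∑ ω, p α * pfi ω α * trMulLog (ρf α ω) - ∑ α, p α * trMulLog (ηf α) := by
    rw [← Finset.sum_sub_distrib, Finset.sum_filter]
    refine Finset.sum_congr rfl fun α _ => ?_
    split_ifs with h
    · simp only [hchi_α, mul_sub, Finset.mul_sum, mul_assoc]
    · simp [le_antisymm (not_lt.mp h) (hp α)]
  rw [hchi_f, hchi_i, hsum_ω, hsum_α, Finset.sum_comm]
  ring
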